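/- arXiv:0901.1406 — 2 statements merged into one kernel-verified Lean document; each statement's English description precedes it below -/
import Mathlib

section
/- With the standard Lie bracket of vector fields on ℝ⁸, the following commutation relations hold identically: (1/2)[Y_{j4}, Y_{j5}] = Y₄₅, (1/2)[Y_{j4}, Y_{j6}] = Y₄₆, and (1/2)[Y_{j5}, Y_{j6}] = Y₅₆ for each j = 0, 1, 2, 3 (where Y_{0k} denotes Y_k); and moreover (1/2)[Y₄₇, Y₅₇] = Y₄₅, (1/2)[Y₄₇, Y₆₇] = Y₄₆, and (1/2)[Y₅₇, Y₆₇] = Y₅₆. Hence each of the five rank-4 collections H₀ = {Y₄₇,Y₅₇,Y₆₇}, H₁ = {Y₃₄,Y₃₅,Y₃₆,Y₃₇}, H₂ = {Y₂₄,Y₂₅,Y₂₆,Y₂₇}, H₃ = {Y₁₄,Y₁₅,Y₁₆,Y₁₇}, H₄ = {Y₄,Y₅,Y₆,Y₇} generates the vertical fields Y₄₅, Y₄₆, Y₅₆ by a single bracket. -/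
noncomputable section

/-- Lie bracket of vector fields on `ℝ⁸`: `[F,G](y) = DG(y)·F(y) − DF(y)·G(y)`. -/
def lieB (F G : (Fin 8 → ℝ) → Fin 8 → ℝ) (y : Fin 8 → ℝ) : Fin 8 → ℝ :=
  fderiv ℝ G y (F y) - fderiv ℝ F y (G y)

def Y4 (y : Fin 8 → ℝ) : Fin 8 → ℝ := ![-y 4, y 5, y 6, -y 7, y 0, -y 1, -y 2, y 3]
def Y5 (y : Fin 8 → ℝ) : Fin 8 → ℝ := ![-y 5, -y 4, -y 7, -y 6, y 1, y 0, y 3, y 2]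
def Y6 (y : Fin 8 → ℝ) : Fin 8 → ℝ := ![-y 6, y 7, -y 4, y 5, y 2, -y 3, y 0, -y 1]
def Y14 (y : Fin 8 → ℝ) : Fin 8 → ℝ := ![y 5, y 4, -y 7, -y 6, -y 1, -y 0, y 3, y 2]
def Y15 (y : Fin 8 → ℝ) : Fin 8 → ℝ := ![-y 4, y 5, -y 6, y 7, y 0, -y 1, y 2, -y 3]
def Y16 (y : Fin 8 → ℝ) : Fin 8 → ℝ := ![y 7, y 6, y 5, y 4, -y 3, -y 2, -y 1, -y 0]
def Y24 (y : Fin 8 → ℝ) : Fin 8 → ℝ := ![y 6, y 7, y 4, y 5, -y 2, -y 3, -y 0, -y 1]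
def Y25 (y : Fin 8 → ℝ) : Fin 8 → ℝ := ![-y 7, y 6, y 5, -y 4, y 3, -y 2, -y 1, y 0]
def Y26 (y : Fin 8 → ℝ) : Fin 8 → ℝ := ![-y 4, -y 5, y 6, y 7, y 0, y 1, -y 2, -y 3]
def Y34 (y : Fin 8 → ℝ) : Fin 8 → ℝ := ![-y 7, y 6, -y 5, y 4, -y 3, y 2, -y 1, y 0]
def Y35 (y : Fin 8 → ℝ) : Fin 8 → ℝ := ![-y 6, -y 7, y 4, y 5, -y 2, -y 3, y 0, y 1]
def Y36 (y : Fin 8 → ℝ) : Fin 8 → ℝ := ![y 5, -y 4, -y 7, y 6, y 1, -y 0, -y 3, y 2]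
def Y47 (y : Fin 8 → ℝ) : Fin 8 → ℝ := ![-y 3, y 2, -y 1, y 0, y 7, -y 6, y 5, -y 4]
def Y57 (y : Fin 8 → ℝ) : Fin 8 → ℝ := ![-y 2, -y 3, y 0, y 1, y 6, y 7, -y 4, -y 5]
def Y67 (y : Fin 8 → ℝ) : Fin 8 → ℝ := ![y 1, -y 0, -y 3, y 2, -y 5, y 4, y 7, -y 6]
def Y45 (y : Fin 8 → ℝ) : Fin 8 → ℝ := ![y 1, -y 0, -y 3, y 2, y 5, -y 4, -y 7, y 6]
def Y46 (y : Fin 8 → ℝ) : Fin 8 → ℝ := ![y 2, y 3, -y 0, -y 1, y 6, y 7, -y 4, -y 5]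
def Y56 (y : Fin 8 → ℝ) : Fin 8 → ℝ := ![-y 3, y 2, -y 1, y 0, -y 7, y 6, -y 5, y 4]

/-- A linear vector field on `ℝ⁸` is its own derivative. -/
theorem fderiv_of_isLinear {F : (Fin 8 → ℝ) → Fin 8 → ℝ} (hF : IsLinearMap ℝ F)
    (y v : Fin 8 → ℝ) : fderiv ℝ F y v = F v := by
  have h : fderiv ℝ (LinearMap.toContinuousLinearMap (IsLinearMap.mk' F hF)) y v = F v := by
    rw [ContinuousLinearMap.fderiv]
    rfl
  exact h

/-- The bracket of two linear vector fields is the commutator. -/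
theorem lieB_of_isLinear {F G H : (Fin 8 → ℝ) → Fin 8 → ℝ} (hF : IsLinearMap ℝ F)
    (hG : IsLinearMap ℝ G) (y : Fin 8 → ℝ)
    (h : ∀ i, G (F y) i - F (G y) i = 2 * H y i) :
    ((1 : ℝ) / 2) • lieB F G y = H y := by
  ext i
  simp only [lieB, fderiv_of_isLinear hF, fderiv_of_isLinear hG, Pi.smul_apply, Pi.sub_apply,
    smul_eq_mul, h]
  ring

theorem lin_Y4 : IsLinearMap ℝ Y4 := by
  constructor <;> intros <;> ext i <;> fin_cases i <;> simp [Y4] <;> ring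

theorem lin_Y5 : IsLinearMap ℝ Y5 := by
  constructor <;> intros <;> ext i <;> fin_cases i <;> simp [Y5] <;> ring

theorem lin_Y6 : IsLinearMap ℝ Y6 := by
  constructor <;> intros <;> ext i <;> fin_cases i <;> simp [Y6] <;> ring

theorem lin_Y14 : IsLinearMap ℝ Y14 := by
  constructor <;> intros <;> ext i <;> fin_cases i <;> simp [Y14] <;> ring

theorem lin_Y15 : IsLinearMap ℝ Y15 := by
  constructor <;> intros <;> ext i <;> fin_cases i <;> simp [Y15] <;> ring

theorem lin_Y16 : IsLinearMap ℝ Y16 := by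
  constructor <;> intros <;> ext i <;> fin_cases i <;> simp [Y16] <;> ring

theorem lin_Y24 : IsLinearMap ℝ Y24 := by
  constructor <;> intros <;> ext i <;> fin_cases i <;> simp [Y24] <;> ring

theorem lin_Y25 : IsLinearMap ℝ Y25 := by
  constructor <;> intros <;> ext i <;> fin_cases i <;> simp [Y25] <;> ring

theorem lin_Y26 : IsLinearMap ℝ Y26 := by
  constructor <;> intros <;> ext i <;> fin_cases i <;> simp [Y26] <;> ring

theorem lin_Y34 : IsLinearMap ℝ Y34 := by
  constructor <;> intros <;> ext i <;> fin_cases i <;> simp [Y34] <;> ring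

theorem lin_Y35 : IsLinearMap ℝ Y35 := by
  constructor <;> intros <;> ext i <;> fin_cases i <;> simp [Y35] <;> ring

theorem lin_Y36 : IsLinearMap ℝ Y36 := by
  constructor <;> intros <;> ext i <;> fin_cases i <;> simp [Y36] <;> ring

theorem lin_Y47 : IsLinearMap ℝ Y47 := by
  constructor <;> intros <;> ext i <;> fin_cases i <;> simp [Y47] <;> ring

theorem lin_Y57 : IsLinearMap ℝ Y57 := by
  constructor <;> intros <;> ext i <;> fin_cases i <;> simp [Y57] <;> ring

theorem lin_Y67 : IsLinearMap ℝ Y67 := by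
  constructor <;> intros <;> ext i <;> fin_cases i <;> simp [Y67] <;> ring

/-- The commutation relations `(1/2)[Y_{j4}, Y_{j5}] = Y₄₅`, `(1/2)[Y_{j4}, Y_{j6}] = Y₄₆`,
`(1/2)[Y_{j5}, Y_{j6}] = Y₅₆` for `j = 0, 1, 2, 3` (with `Y_{0k} = Y_k`), and
`(1/2)[Y₄₇, Y₅₇] = Y₄₅`, `(1/2)[Y₄₇, Y₆₇] = Y₄₆`, `(1/2)[Y₅₇, Y₆₇] = Y₅₆`. Hence each of
the five rank-4 collections `H₀, H₁, H₂, H₃, H₄` generates the vertical fields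
`Y₄₅, Y₄₆, Y₅₆` by a single bracket. -/
theorem S7_commutation_relations :
    ∀ y : Fin 8 → ℝ,
      ((1 : ℝ) / 2) • lieB Y4 Y5 y = Y45 y ∧
      ((1 : ℝ) / 2) • lieB Y4 Y6 y = Y46 y ∧
      ((1 : ℝ) / 2) • lieB Y5 Y6 y = Y56 y ∧
      ((1 : ℝ) / 2) • lieB Y14 Y15 y = Y45 y ∧
      ((1 : ℝ) / 2) • lieB Y14 Y16 y = Y46 y ∧
      ((1 : ℝ) / 2) • lieB Y15 Y16 y = Y56 y ∧
      ((1 : ℝ) / 2) • lieB Y24 Y25 y = Y45 y ∧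
      ((1 : ℝ) / 2) • lieB Y24 Y26 y = Y46 y ∧
      ((1 : ℝ) / 2) • lieB Y25 Y26 y = Y56 y ∧
      ((1 : ℝ) / 2) • lieB Y34 Y35 y = Y45 y ∧
      ((1 : ℝ) / 2) • lieB Y34 Y36 y = Y46 y ∧
      ((1 : ℝ) / 2) • lieB Y35 Y36 y = Y56 y ∧
      ((1 : ℝ) / 2) • lieB Y47 Y57 y = Y45 y ∧
      ((1 : ℝ) / 2) • lieB Y47 Y67 y = Y46 y ∧
      ((1 : ℝ) / 2) • lieB Y57 Y67 y = Y56 y := by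
  intro y
  refine ⟨lieB_of_isLinear lin_Y4 lin_Y5 y ?_,
    lieB_of_isLinear lin_Y4 lin_Y6 y ?_,
    lieB_of_isLinear lin_Y5 lin_Y6 y ?_,
    lieB_of_isLinear lin_Y14 lin_Y15 y ?_,
    lieB_of_isLinear lin_Y14 lin_Y16 y ?_,
    lieB_of_isLinear lin_Y15 lin_Y16 y ?_,
    lieB_of_isLinear lin_Y24 lin_Y25 y ?_,
    lieB_of_isLinear lin_Y24 lin_Y26 y ?_,
    lieB_of_isLinear lin_Y25 lin_Y26 y ?_,
    lieB_of_isLinear lin_Y34 lin_Y35 y ?_,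
    lieB_of_isLinear lin_Y34 lin_Y36 y ?_,
    lieB_of_isLinear lin_Y35 lin_Y36 y ?_,
    lieB_of_isLinear lin_Y47 lin_Y57 y ?_,
    lieB_of_isLinear lin_Y47 lin_Y67 y ?_,
    lieB_of_isLinear lin_Y57 lin_Y67 y ?_⟩
  all_goals
    intro i
    fin_cases i <;> simp [Y4, Y5, Y6, Y14, Y15, Y16, Y24, Y25, Y26, Y34, Y35, Y36, Y47, Y57, Y67, Y45, Y46, Y56] <;> ring
end
end

section
/- Let y ∈ S⁷ satisfy a₀₀(y) ≠ 0 (equivalently, y₀²+y₁²+y₂²+y₃² ≠ 1/2). Then for each m ∈ {1,2,3,4}, the seven vectors consisting of the four vectors of the collection H_m evaluated at y together with Y₄₅(y), Y₄₆(y), Y₅₆(y) are linearly independent and their span is the whole tangent space T_yS⁷ = {v ∈ ℝ⁸ : ⟨v, y⟩ = 0}; i.e. span{H_m(y)} ⊕ span{Y₄₅(y), Y₄₆(y), Y₅₆(y)} = T_yS⁷. -/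
noncomputable section

/-- Standard inner product on `ℝ⁸`. -/
def ip8 (u v : Fin 8 → ℝ) : ℝ := ∑ i, u i * v i

def a00 (y : Fin 8 → ℝ) : ℝ :=
  y 0 ^ 2 + y 1 ^ 2 + y 2 ^ 2 + y 3 ^ 2 - y 4 ^ 2 - y 5 ^ 2 - y 6 ^ 2 - y 7 ^ 2

def Y7 (y : Fin 8 → ℝ) : Fin 8 → ℝ := ![-y 7, -y 6, y 5, y 4, -y 3, -y 2, y 1, y 0]
def Y17 (y : Fin 8 → ℝ) : Fin 8 → ℝ := ![-y 6, y 7, y 4, -y 5, -y 2, y 3, y 0, -y 1]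
def Y27 (y : Fin 8 → ℝ) : Fin 8 → ℝ := ![y 5, -y 4, y 7, -y 6, y 1, -y 0, y 3, -y 2]
def Y37 (y : Fin 8 → ℝ) : Fin 8 → ℝ := ![y 4, y 5, y 6, y 7, -y 0, -y 1, -y 2, -y 3]
/-- Abstract linear algebra: the Gram matrix has the displayed block form, hence is invertible. -/
theorem frame_aux (y h1 h2 h3 h4 v1 v2 v3 : Fin 8 → ℝ) (s t1 t2 t3 a : ℝ)
    (hy : ip8 y y = 1) (ha : a ≠ 0) (hs : s ^ 2 + t1 ^ 2 + t2 ^ 2 + t3 ^ 2 + a ^ 2 = 1)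
    (o1 : ip8 h1 y = 0) (o2 : ip8 h2 y = 0) (o3 : ip8 h3 y = 0) (o4 : ip8 h4 y = 0)
    (o5 : ip8 v1 y = 0) (o6 : ip8 v2 y = 0) (o7 : ip8 v3 y = 0)
    (e1 : ∀ x1 x2 x3 x4 x5 x6 x7 : ℝ,
      ip8 (x1 • h1 + x2 • h2 + x3 • h3 + x4 • h4 + x5 • v1 + x6 • v2 + x7 • v3) h1 = x1 + s * x7)
    (e2 : ∀ x1 x2 x3 x4 x5 x6 x7 : ℝ,
      ip8 (x1 • h1 + x2 • h2 + x3 • h3 + x4 • h4 + x5 • v1 + x6 • v2 + x7 • v3) h2 = x2 - s * x6)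
    (e3 : ∀ x1 x2 x3 x4 x5 x6 x7 : ℝ,
      ip8 (x1 • h1 + x2 • h2 + x3 • h3 + x4 • h4 + x5 • v1 + x6 • v2 + x7 • v3) h3 = x3 + s * x5)
    (e4 : ∀ x1 x2 x3 x4 x5 x6 x7 : ℝ,
      ip8 (x1 • h1 + x2 • h2 + x3 • h3 + x4 • h4 + x5 • v1 + x6 • v2 + x7 • v3) h4
        = x4 + t1 * x5 + t2 * x6 + t3 * x7)
    (e5 : ∀ x1 x2 x3 x4 x5 x6 x7 : ℝ,
      ip8 (x1 • h1 + x2 • h2 + x3 • h3 + x4 • h4 + x5 • v1 + x6 • v2 + x7 • v3) v1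
        = s * x3 + t1 * x4 + x5)
    (e6 : ∀ x1 x2 x3 x4 x5 x6 x7 : ℝ,
      ip8 (x1 • h1 + x2 • h2 + x3 • h3 + x4 • h4 + x5 • v1 + x6 • v2 + x7 • v3) v2
        = - s * x2 + t2 * x4 + x6)
    (e7 : ∀ x1 x2 x3 x4 x5 x6 x7 : ℝ,
      ip8 (x1 • h1 + x2 • h2 + x3 • h3 + x4 • h4 + x5 • v1 + x6 • v2 + x7 • v3) v3
        = s * x1 + t3 * x4 + x7) :
    LinearIndependent ℝ ![h1, h2, h3, h4, v1, v2, v3] ∧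
      ∀ v : Fin 8 → ℝ,
        v ∈ Submodule.span ℝ {h1, h2, h3, h4, v1, v2, v3} ↔ ip8 v y = 0 := by
  have hz : ∀ w, ip8 0 w = 0 := fun w => by simp [ip8]
  have hLI : LinearIndependent ℝ ![h1, h2, h3, h4, v1, v2, v3] := by
    rw [Fintype.linearIndependent_iff]
    intro g hg
    have hg' : g 0 • h1 + g 1 • h2 + g 2 • h3 + g 3 • h4 + g 4 • v1 + g 5 • v2 + g 6 • v3 = 0 := by
      rw [← hg, Fin.sum_univ_seven]; rfl
    have f1 := e1 (g 0) (g 1) (g 2) (g 3) (g 4) (g 5) (g 6)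
    have f2 := e2 (g 0) (g 1) (g 2) (g 3) (g 4) (g 5) (g 6)
    have f3 := e3 (g 0) (g 1) (g 2) (g 3) (g 4) (g 5) (g 6)
    have f4 := e4 (g 0) (g 1) (g 2) (g 3) (g 4) (g 5) (g 6)
    have f5 := e5 (g 0) (g 1) (g 2) (g 3) (g 4) (g 5) (g 6)
    have f6 := e6 (g 0) (g 1) (g 2) (g 3) (g 4) (g 5) (g 6)
    have f7 := e7 (g 0) (g 1) (g 2) (g 3) (g 4) (g 5) (g 6)
    rw [hg', hz] at f1 f2 f3 f4 f5 f6 f7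
    have g0 : g 0 = - s * g 6 := by linarith
    have g1 : g 1 = s * g 5 := by linarith
    have g2 : g 2 = - s * g 4 := by linarith
    rw [g0] at f7
    rw [g1] at f6
    rw [g2] at f5
    have ha2 : 0 < a ^ 2 := by positivity
    have g3 : g 3 = 0 := by
      have : a ^ 2 * g 3 = 0 := by
        linear_combination (g 3) * hs - (1 - s ^ 2) * f4 + t1 * f5 + t2 * f6 + t3 * f7
      exact (mul_eq_zero.mp this).resolve_left ha2.ne'
    have hs' : 1 - s ^ 2 ≠ 0 := by nlinarith [sq_nonneg t1, sq_nonneg t2, sq_nonneg t3]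
    have g4 : g 4 = 0 := by
      have : (1 - s ^ 2) * g 4 = 0 := by rw [g3] at f5; linear_combination -f5
      exact (mul_eq_zero.mp this).resolve_left hs'
    have g5 : g 5 = 0 := by
      have : (1 - s ^ 2) * g 5 = 0 := by rw [g3] at f6; linear_combination -f6
      exact (mul_eq_zero.mp this).resolve_left hs'
    have g6 : g 6 = 0 := by
      have : (1 - s ^ 2) * g 6 = 0 := by rw [g3] at f7; linear_combination -f7
      exact (mul_eq_zero.mp this).resolve_left hs'
    rw [g6, mul_zero] at g0
    rw [g5, mul_zero] at g1
    rw [g4, mul_zero] at g2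
    intro i
    fin_cases i <;> assumption
  refine ⟨hLI, ?_⟩
  let φ : Module.Dual ℝ (Fin 8 → ℝ) :=
    { toFun := fun v => ip8 v y
      map_add' := fun u v => by simp [ip8, add_mul, Finset.sum_add_distrib]
      map_smul' := fun c v => by simp [ip8, Finset.mul_sum, mul_assoc] }
  have hφ : ∀ v, φ v = ip8 v y := fun v => rfl
  have hφ0 : φ ≠ 0 := by
    intro h
    have h2 := hφ y
    rw [h, hy] at h2
    simp at h2
  have hk := Module.Dual.finrank_ker_add_one_of_ne_zero hφ0
  have hr : Set.range ![h1, h2, h3, h4, v1, v2, v3] = {h1, h2, h3, h4, v1, v2, v3} := by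
    simp only [Matrix.range_cons, Matrix.range_empty, Set.union_empty, Set.singleton_union]
  have hf := finrank_span_eq_card hLI
  rw [hr] at hf
  have hle : Submodule.span ℝ {h1, h2, h3, h4, v1, v2, v3} ≤ LinearMap.ker φ := by
    rw [Submodule.span_le]
    intro x hx
    simp only [Set.mem_insert_iff, Set.mem_singleton_iff] at hx
    rw [SetLike.mem_coe, LinearMap.mem_ker, hφ]
    rcases hx with rfl | rfl | rfl | rfl | rfl | rfl | rfl <;> assumption
  have heq := Submodule.eq_of_le_of_finrank_eq hle (by simp at hk hf; omega)
  intro v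
  rw [heq, LinearMap.mem_ker, hφ]

set_option maxHeartbeats 2000000 in
set_option linter.unusedSimpArgs false in
/-- For `y ∈ S⁷` with `a₀₀(y) ≠ 0`, each of the four collections `H_m` (`m = 1, 2, 3, 4`)
together with the vertical vectors `Y₄₅(y), Y₄₆(y), Y₅₆(y)` gives seven linearly
independent vectors spanning the whole tangent space `T_yS⁷ = {v : ⟨v, y⟩ = 0}`. -/
theorem S7_transversality_away_from_S1 (y : Fin 8 → ℝ)
    (hy : ∑ i, y i ^ 2 = 1) (ha : a00 y ≠ 0) :
    (LinearIndependent ℝ ![Y34 y, Y35 y, Y36 y, Y37 y, Y45 y, Y46 y, Y56 y] ∧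
      ∀ v : Fin 8 → ℝ,
        v ∈ Submodule.span ℝ
            {Y34 y, Y35 y, Y36 y, Y37 y, Y45 y, Y46 y, Y56 y} ↔ ip8 v y = 0) ∧
    (LinearIndependent ℝ ![Y24 y, Y25 y, Y26 y, Y27 y, Y45 y, Y46 y, Y56 y] ∧
      ∀ v : Fin 8 → ℝ,
        v ∈ Submodule.span ℝ
            {Y24 y, Y25 y, Y26 y, Y27 y, Y45 y, Y46 y, Y56 y} ↔ ip8 v y = 0) ∧
    (LinearIndependent ℝ ![Y14 y, Y15 y, Y16 y, Y17 y, Y45 y, Y46 y, Y56 y] ∧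
      ∀ v : Fin 8 → ℝ,
        v ∈ Submodule.span ℝ
            {Y14 y, Y15 y, Y16 y, Y17 y, Y45 y, Y46 y, Y56 y} ↔ ip8 v y = 0) ∧
    (LinearIndependent ℝ ![Y4 y, Y5 y, Y6 y, Y7 y, Y45 y, Y46 y, Y56 y] ∧
      ∀ v : Fin 8 → ℝ,
        v ∈ Submodule.span ℝ
            {Y4 y, Y5 y, Y6 y, Y7 y, Y45 y, Y46 y, Y56 y} ↔ ip8 v y = 0) := by
  have hN : y 0 ^ 2 + y 1 ^ 2 + y 2 ^ 2 + y 3 ^ 2 + y 4 ^ 2 + y 5 ^ 2 + y 6 ^ 2 + y 7 ^ 2 = 1 := by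
    rw [← hy, Fin.sum_univ_eight]
  have hyy : ip8 y y = 1 := by
    rw [← hy]; simp only [ip8, sq]
  refine ⟨?_, ?_, ?_, ?_⟩
  · refine frame_aux y _ _ _ _ _ _ _ (ip8 (Y34 y) (Y56 y)) (ip8 (Y37 y) (Y45 y))
      (ip8 (Y37 y) (Y46 y)) (ip8 (Y37 y) (Y56 y)) (a00 y) hyy ha ?_ ?_ ?_ ?_ ?_ ?_ ?_ ?_ ?_ ?_ ?_ ?_ ?_ ?_ ?_
    · simp [ip8, Fin.sum_univ_eight, Y34, Y35, Y36, Y37, Y45, Y46, Y56]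
      rw [a00]
      linear_combination (y 0 ^ 2 + y 1 ^ 2 + y 2 ^ 2 + y 3 ^ 2 + y 4 ^ 2 + y 5 ^ 2 + y 6 ^ 2 + y 7 ^ 2 + 1) * hN
    iterate 7
      · simp [ip8, Fin.sum_univ_eight, Y34, Y35, Y36, Y37, Y45, Y46, Y56]
        try ring
    · intro x1 x2 x3 x4 x5 x6 x7
      simp [ip8, Fin.sum_univ_eight, Y34, Y35, Y36, Y37, Y45, Y46, Y56]
      linear_combination x1 * hN
    · intro x1 x2 x3 x4 x5 x6 x7
      simp [ip8, Fin.sum_univ_eight, Y34, Y35, Y36, Y37, Y45, Y46, Y56]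
      linear_combination x2 * hN
    · intro x1 x2 x3 x4 x5 x6 x7
      simp [ip8, Fin.sum_univ_eight, Y34, Y35, Y36, Y37, Y45, Y46, Y56]
      linear_combination x3 * hN
    · intro x1 x2 x3 x4 x5 x6 x7
      simp [ip8, Fin.sum_univ_eight, Y34, Y35, Y36, Y37, Y45, Y46, Y56]
      linear_combination x4 * hN
    · intro x1 x2 x3 x4 x5 x6 x7
      simp [ip8, Fin.sum_univ_eight, Y34, Y35, Y36, Y37, Y45, Y46, Y56]
      linear_combination x5 * hN
    · intro x1 x2 x3 x4 x5 x6 x7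
      simp [ip8, Fin.sum_univ_eight, Y34, Y35, Y36, Y37, Y45, Y46, Y56]
      linear_combination x6 * hN
    · intro x1 x2 x3 x4 x5 x6 x7
      simp [ip8, Fin.sum_univ_eight, Y34, Y35, Y36, Y37, Y45, Y46, Y56]
      linear_combination x7 * hN
  · refine frame_aux y _ _ _ _ _ _ _ (ip8 (Y24 y) (Y56 y)) (ip8 (Y27 y) (Y45 y))
      (ip8 (Y27 y) (Y46 y)) (ip8 (Y27 y) (Y56 y)) (a00 y) hyy ha ?_ ?_ ?_ ?_ ?_ ?_ ?_ ?_ ?_ ?_ ?_ ?_ ?_ ?_ ?_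
    · simp [ip8, Fin.sum_univ_eight, Y24, Y25, Y26, Y27, Y45, Y46, Y56]
      rw [a00]
      linear_combination (y 0 ^ 2 + y 1 ^ 2 + y 2 ^ 2 + y 3 ^ 2 + y 4 ^ 2 + y 5 ^ 2 + y 6 ^ 2 + y 7 ^ 2 + 1) * hN
    iterate 7
      · simp [ip8, Fin.sum_univ_eight, Y24, Y25, Y26, Y27, Y45, Y46, Y56]
        try ring
    · intro x1 x2 x3 x4 x5 x6 x7
      simp [ip8, Fin.sum_univ_eight, Y24, Y25, Y26, Y27, Y45, Y46, Y56]
      linear_combination x1 * hN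
    · intro x1 x2 x3 x4 x5 x6 x7
      simp [ip8, Fin.sum_univ_eight, Y24, Y25, Y26, Y27, Y45, Y46, Y56]
      linear_combination x2 * hN
    · intro x1 x2 x3 x4 x5 x6 x7
      simp [ip8, Fin.sum_univ_eight, Y24, Y25, Y26, Y27, Y45, Y46, Y56]
      linear_combination x3 * hN
    · intro x1 x2 x3 x4 x5 x6 x7
      simp [ip8, Fin.sum_univ_eight, Y24, Y25, Y26, Y27, Y45, Y46, Y56]
      linear_combination x4 * hN
    · intro x1 x2 x3 x4 x5 x6 x7
      simp [ip8, Fin.sum_univ_eight, Y24, Y25, Y26, Y27, Y45, Y46, Y56]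
      linear_combination x5 * hN
    · intro x1 x2 x3 x4 x5 x6 x7
      simp [ip8, Fin.sum_univ_eight, Y24, Y25, Y26, Y27, Y45, Y46, Y56]
      linear_combination x6 * hN
    · intro x1 x2 x3 x4 x5 x6 x7
      simp [ip8, Fin.sum_univ_eight, Y24, Y25, Y26, Y27, Y45, Y46, Y56]
      linear_combination x7 * hN
  · refine frame_aux y _ _ _ _ _ _ _ (ip8 (Y14 y) (Y56 y)) (ip8 (Y17 y) (Y45 y))
      (ip8 (Y17 y) (Y46 y)) (ip8 (Y17 y) (Y56 y)) (a00 y) hyy ha ?_ ?_ ?_ ?_ ?_ ?_ ?_ ?_ ?_ ?_ ?_ ?_ ?_ ?_ ?_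
    · simp [ip8, Fin.sum_univ_eight, Y14, Y15, Y16, Y17, Y45, Y46, Y56]
      rw [a00]
      linear_combination (y 0 ^ 2 + y 1 ^ 2 + y 2 ^ 2 + y 3 ^ 2 + y 4 ^ 2 + y 5 ^ 2 + y 6 ^ 2 + y 7 ^ 2 + 1) * hN
    iterate 7
      · simp [ip8, Fin.sum_univ_eight, Y14, Y15, Y16, Y17, Y45, Y46, Y56]
        try ring
    · intro x1 x2 x3 x4 x5 x6 x7
      simp [ip8, Fin.sum_univ_eight, Y14, Y15, Y16, Y17, Y45, Y46, Y56]
      linear_combination x1 * hN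
    · intro x1 x2 x3 x4 x5 x6 x7
      simp [ip8, Fin.sum_univ_eight, Y14, Y15, Y16, Y17, Y45, Y46, Y56]
      linear_combination x2 * hN
    · intro x1 x2 x3 x4 x5 x6 x7
      simp [ip8, Fin.sum_univ_eight, Y14, Y15, Y16, Y17, Y45, Y46, Y56]
      linear_combination x3 * hN
    · intro x1 x2 x3 x4 x5 x6 x7
      simp [ip8, Fin.sum_univ_eight, Y14, Y15, Y16, Y17, Y45, Y46, Y56]
      linear_combination x4 * hN
    · intro x1 x2 x3 x4 x5 x6 x7
      simp [ip8, Fin.sum_univ_eight, Y14, Y15, Y16, Y17, Y45, Y46, Y56]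
      linear_combination x5 * hN
    · intro x1 x2 x3 x4 x5 x6 x7
      simp [ip8, Fin.sum_univ_eight, Y14, Y15, Y16, Y17, Y45, Y46, Y56]
      linear_combination x6 * hN
    · intro x1 x2 x3 x4 x5 x6 x7
      simp [ip8, Fin.sum_univ_eight, Y14, Y15, Y16, Y17, Y45, Y46, Y56]
      linear_combination x7 * hN
  · refine frame_aux y _ _ _ _ _ _ _ (ip8 (Y4 y) (Y56 y)) (ip8 (Y7 y) (Y45 y))
      (ip8 (Y7 y) (Y46 y)) (ip8 (Y7 y) (Y56 y)) (a00 y) hyy ha ?_ ?_ ?_ ?_ ?_ ?_ ?_ ?_ ?_ ?_ ?_ ?_ ?_ ?_ ?_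
    · simp [ip8, Fin.sum_univ_eight, Y4, Y5, Y6, Y7, Y45, Y46, Y56]
      rw [a00]
      linear_combination (y 0 ^ 2 + y 1 ^ 2 + y 2 ^ 2 + y 3 ^ 2 + y 4 ^ 2 + y 5 ^ 2 + y 6 ^ 2 + y 7 ^ 2 + 1) * hN
    iterate 7
      · simp [ip8, Fin.sum_univ_eight, Y4, Y5, Y6, Y7, Y45, Y46, Y56]
        try ring
    · intro x1 x2 x3 x4 x5 x6 x7
      simp [ip8, Fin.sum_univ_eight, Y4, Y5, Y6, Y7, Y45, Y46, Y56]
      linear_combination x1 * hN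
    · intro x1 x2 x3 x4 x5 x6 x7
      simp [ip8, Fin.sum_univ_eight, Y4, Y5, Y6, Y7, Y45, Y46, Y56]
      linear_combination x2 * hN
    · intro x1 x2 x3 x4 x5 x6 x7
      simp [ip8, Fin.sum_univ_eight, Y4, Y5, Y6, Y7, Y45, Y46, Y56]
      linear_combination x3 * hN
    · intro x1 x2 x3 x4 x5 x6 x7
      simp [ip8, Fin.sum_univ_eight, Y4, Y5, Y6, Y7, Y45, Y46, Y56]
      linear_combination x4 * hN
    · intro x1 x2 x3 x4 x5 x6 x7
      simp [ip8, Fin.sum_univ_eight, Y4, Y5, Y6, Y7, Y45, Y46, Y56]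
      linear_combination x5 * hN
    · intro x1 x2 x3 x4 x5 x6 x7
      simp [ip8, Fin.sum_univ_eight, Y4, Y5, Y6, Y7, Y45, Y46, Y56]
      linear_combination x6 * hN
    · intro x1 x2 x3 x4 x5 x6 x7
      simp [ip8, Fin.sum_univ_eight, Y4, Y5, Y6, Y7, Y45, Y46, Y56]
      linear_combination x7 * hN
end
end
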